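/- Let p > 1, let x₁,…,x_N be distinct points of the open unit ball B² ⊂ ℝ², let n₁,…,n_N ∈ ℤ, and let V : B² → ℝ² be measurable with ∫_{B²} ‖V‖^p dx < ∞ and with distributional divergence equal to 2π ∑_{i=1}^N n_i δ_{x_i}, in the sense that ∫_{B²} ⟨V(x), ∇φ(x)⟩ dx = 2π ∑_{i=1}^N n_i φ(x_i) for all smooth compactly supported φ : ℝ² → ℝ with support in B². Then there exists a measurable map u = (u₁, u₂) : B² → ℝ² with ‖u(x)‖ = 1 for almost every x ∈ B², admitting weak partial derivatives in L^p — i.e., there exist measurable functions g_{ij} : B² → ℝ (i,j ∈ {1,2}) with ∫_{B²} |g_{ij}|^p dx < ∞ and ∫_{B²} u_i(x) ∂_jφ(x) dx = −∫_{B²} g_{ij}(x) φ(x) dx for all smooth compactly supported φ with support in B² — such that V = u₁ ∇⊥u₂ − u₂ ∇⊥u₁ almost everywhere on B², where ∇⊥u_i := (−g_{i2}, g_{i1}). -/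

import Mathlib

open MeasureTheory Metric Real RealInnerProductSpace

section Helpers
open scoped Convolution ENNReal

abbrev E2 := EuclideanSpace ℝ (Fin 2)

/-- the coordinate map -/
def TT (p : ℝ × ℝ) : E2 := !₂[p.1, p.2]

@[simp] lemma TT_zero (p : ℝ × ℝ) : TT p 0 = p.1 := rfl
@[simp] lemma TT_one (p : ℝ × ℝ) : TT p 1 = p.2 := rfl

lemma TT_eq : TT = ⇑(MeasurableEquiv.toLp 2 (Fin 2 → ℝ)) ∘ ⇑(MeasurableEquiv.finTwoArrow (α := ℝ)).symm := by
  funext p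
  ext i
  fin_cases i <;> rfl

lemma TT_mp : MeasurePreserving TT := by
  rw [TT_eq]
  exact (PiLp.volume_preserving_toLp (Fin 2)).comp ((volume_preserving_finTwoArrow ℝ).symm)

lemma TT_me : MeasurableEmbedding TT := by
  rw [TT_eq]
  exact (MeasurableEquiv.toLp 2 (Fin 2 → ℝ)).measurableEmbedding.comp
    ((MeasurableEquiv.finTwoArrow (α := ℝ)).symm.measurableEmbedding)

lemma hasDerivAt_of_line {g : E2 → ℂ} {v : E2} {d : ℂ} {γ : ℝ → E2} {s : ℝ}
    (hγ : ∀ h, γ h = γ s + (h - s) • v) (h : HasLineDerivAt ℝ g d (γ s) v) :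
    HasDerivAt (fun s => g (γ s)) d s := by
  have h2 : HasDerivAt (fun t : ℝ => g (γ s + t • v)) d (s - s) := by
    simpa [HasLineDerivAt] using h
  have h3 := HasDerivAt.comp_sub_const s s h2
  refine h3.congr_of_eventuallyEq (Filter.Eventually.of_forall fun t => ?_)
  simp only [← hγ]

lemma integral_line_zero (S : Set E2) (hS : S.Finite) (j : Fin 2) (g g' : E2 → ℂ)
    (hg : Integrable g) (hg' : Integrable g')
    (h : ∀ x ∉ S, HasLineDerivAt ℝ g (g' x) x (EuclideanSpace.single j 1)) :
    ∫ x, g' x = 0 := by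
  rw [← TT_mp.integral_comp TT_me]
  have i1 : Integrable (fun p => g (TT p)) (volume.prod volume) := (TT_mp.integrable_comp_emb TT_me).2 hg
  have i2 : Integrable (fun p => g' (TT p)) (volume.prod volume) := (TT_mp.integrable_comp_emb TT_me).2 hg'
  have hnull : ∀ k : Fin 2, ∀ᵐ t : ℝ, t ∉ (fun x : E2 => x k) '' S := fun k =>
    ((hS.image _).countable.ae_notMem volume)
  fin_cases j
  · rw [Measure.volume_eq_prod, integral_prod_symm _ i2]
    refine integral_eq_zero_of_ae ?_
    filter_upwards [hnull 1, i1.prod_left_ae, i2.prod_left_ae] with t ht h1 h2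
    refine integral_eq_zero_of_hasDerivAt_of_integrable (f := fun s => g (TT (s, t))) ?_ h2 h1
    intro s
    refine hasDerivAt_of_line (γ := fun s => TT (s, t)) ?_ (h _ ?_)
    · intro u; ext i; fin_cases i <;> simp
    · intro hmem; exact ht ⟨_, hmem, rfl⟩
  · rw [Measure.volume_eq_prod, integral_prod _ i2]
    refine integral_eq_zero_of_ae ?_
    filter_upwards [hnull 0, i1.prod_right_ae, i2.prod_right_ae] with t ht h1 h2
    refine integral_eq_zero_of_hasDerivAt_of_integrable (f := fun s => g (TT (t, s))) ?_ h2 h1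
    intro s
    refine hasDerivAt_of_line (γ := fun s => TT (t, s)) ?_ (h _ ?_)
    · intro u; ext i; fin_cases i <;> simp
    · intro hmem; exact ht ⟨_, hmem, rfl⟩

lemma locInt_inv_norm (a : E2) : LocallyIntegrable (fun y : E2 => ‖y - a‖⁻¹) := by
  have h : LocallyIntegrable (fun y : E2 => ‖y‖⁻¹) := by
    refine locallyIntegrable_of_norm_le_rpow (C := 1) (α := 1) (by simp) (by simp) ?_ ?_
    · refine Filter.Eventually.of_forall fun x => ?_
      simp [Real.rpow_neg_one]
    · exact (measurable_norm.inv).aestronglyMeasurable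
  rw [locallyIntegrable_iff] at h ⊢
  intro k hk
  have hmp : MeasurePreserving (fun y : E2 => y - a) := measurePreserving_sub_right volume a
  have hk2 : IsCompact ((fun y : E2 => y - a) '' k) := hk.image (by fun_prop)
  have := h _ hk2
  have me : MeasurableEmbedding (fun y : E2 => y - a) := (Homeomorph.subRight a).measurableEmbedding
  have h3 := (hmp.integrableOn_comp_preimage me (f := fun y : E2 => ‖y‖⁻¹) (s := (fun y : E2 => y - a) '' k)).2 this
  rwa [Set.preimage_image_eq] at h3
  exact sub_left_injective

/-- fundamental solution -/
lemma integral_radial (a : E2) (φ : E2 → ℝ) (hφ : ContDiff ℝ 1 φ) (hc : HasCompactSupport φ) :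
    ∫ y, (‖y - a‖ ^ 2)⁻¹ * fderiv ℝ φ y (y - a) = - (2 * π * φ a) := by
  have hcf : Continuous (fderiv ℝ φ) := hφ.continuous_fderiv (by norm_num)
  have hcs : HasCompactSupport (fderiv ℝ φ) := hc.fderiv ℝ
  -- translate
  rw [← integral_add_right_eq_self _ a]
  simp only [add_sub_cancel_right]
  rw [← TT_mp.integral_comp TT_me]
  rw [← integral_comp_polarCoord_symm]
  have key : ∀ p ∈ polarCoord.target, p.1 • ((‖TT (polarCoord.symm p)‖ ^ 2)⁻¹ * fderiv ℝ φ (TT (polarCoord.symm p) + a) (TT (polarCoord.symm p)))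
      = fderiv ℝ φ (p.1 • TT (cos p.2, sin p.2) + a) (TT (cos p.2, sin p.2)) := by
    rintro ⟨r, θ⟩ hp
    have hr : 0 < r := hp.1
    have e1 : TT (polarCoord.symm (r, θ)) = r • TT (cos θ, sin θ) := by
      ext i; fin_cases i <;> simp [polarCoord]
    have e2 : ‖TT (cos θ, sin θ)‖ ^ 2 = 1 := by
      simp [EuclideanSpace.norm_sq_eq, Fin.sum_univ_two]
    rw [e1, norm_smul, mul_pow, e2, map_smul]
    simp only [smul_eq_mul, norm_eq_abs, sq_abs, mul_one]
    field_simp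
  have hmeasT : MeasurableSet polarCoord.target := polarCoord.open_target.measurableSet
  rw [setIntegral_congr_fun hmeasT key]
  obtain ⟨R0, hR0⟩ := hc.isCompact.isBounded.subset_closedBall (0 : E2)
  have hvan : ∀ r θ : ℝ, R0 + ‖a‖ < r → r • TT (cos θ, sin θ) + a ∉ tsupport φ := by
    intro r θ hr hmem
    have h1 := hR0 hmem
    rw [mem_closedBall_zero_iff] at h1
    have e2 : ‖TT (cos θ, sin θ)‖ = 1 := by
      simp [EuclideanSpace.norm_eq, Fin.sum_univ_two]
    have h2 : ‖r • TT (cos θ, sin θ)‖ ≤ ‖r • TT (cos θ, sin θ) + a‖ + ‖a‖ := by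
      simpa using norm_sub_le (r • TT (cos θ, sin θ) + a) a
    rw [norm_smul, e2, mul_one] at h2
    have := le_abs_self r
    simp only [norm_eq_abs] at h2
    linarith
  have hTc : Continuous TT := by
    rw [TT_eq]
    exact (PiLp.continuous_toLp 2 _).comp (Homeomorph.finTwoArrow.symm.continuous)
  have hFc : Continuous (fun p : ℝ × ℝ => fderiv ℝ φ (p.1 • TT (cos p.2, sin p.2) + a) (TT (cos p.2, sin p.2))) := by
    fun_prop
  have hint4 : IntegrableOn (fun p : ℝ × ℝ => fderiv ℝ φ (p.1 • TT (cos p.2, sin p.2) + a) (TT (cos p.2, sin p.2))) polarCoord.target := by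
    have h1 : IntegrableOn (fun p : ℝ × ℝ => fderiv ℝ φ (p.1 • TT (cos p.2, sin p.2) + a) (TT (cos p.2, sin p.2))) (Set.Icc 0 (R0 + ‖a‖) ×ˢ Set.Icc (-π) π) :=
      hFc.continuousOn.integrableOn_compact (isCompact_Icc.prod isCompact_Icc)
    refine h1.of_forall_sdiff_eq_zero hmeasT ?_
    rintro ⟨r, θ⟩ ⟨hp, hn⟩
    have hr : 0 < r := hp.1
    have hθ : θ ∈ Set.Ioo (-π) π := hp.2
    have : R0 + ‖a‖ < r := by
      by_contra hcon
      exact hn ⟨⟨hr.le, not_lt.1 hcon⟩, ⟨hθ.1.le, hθ.2.le⟩⟩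
    have h3 : fderiv ℝ φ (r • TT (cos θ, sin θ) + a) = 0 := by
      have := mt (tsupport_fderiv_subset ℝ (f := φ) ·) (hvan r θ this)
      exact image_eq_zero_of_notMem_tsupport this
    simp [h3]
  rw [polarCoord_target] at hint4 ⊢
  rw [Measure.volume_eq_prod] at hint4 ⊢
  rw [IntegrableOn, ← Measure.prod_restrict] at hint4
  rw [← Measure.prod_restrict, integral_prod_symm _ hint4]
  have inner_eq : ∀ θ : ℝ, ∫ r in Set.Ioi (0:ℝ), fderiv ℝ φ (r • TT (cos θ, sin θ) + a) (TT (cos θ, sin θ)) = - φ a := by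
    intro θ
    have hd : ∀ r : ℝ, HasDerivAt (fun r : ℝ => φ (r • TT (cos θ, sin θ) + a)) (fderiv ℝ φ (r • TT (cos θ, sin θ) + a) (TT (cos θ, sin θ))) r := by
      intro r
      have h1 : HasDerivAt (fun r : ℝ => r • TT (cos θ, sin θ) + a) (TT (cos θ, sin θ)) r := by
        simpa using ((hasDerivAt_id r).smul_const (TT (cos θ, sin θ))).add_const a
      exact ((hφ.differentiable (by norm_num)) _).hasFDerivAt.comp_hasDerivAt r h1
    have h5 := integral_Ioi_of_hasDerivAt_of_tendsto (a := 0) (m := 0) (f := fun r : ℝ => φ (r • TT (cos θ, sin θ) + a))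
      (hd 0).continuousAt.continuousWithinAt (fun r _ => hd r) ?_ ?_
    · simpa using h5
    · have hc1 : Continuous (fun r : ℝ => fderiv ℝ φ (r • TT (cos θ, sin θ) + a) (TT (cos θ, sin θ))) := by fun_prop
      refine (hc1.continuousOn.integrableOn_compact (isCompact_Icc (a := 0) (b := R0 + ‖a‖))).of_forall_sdiff_eq_zero measurableSet_Ioi ?_
      rintro r ⟨hr, hn⟩
      have : R0 + ‖a‖ < r := by
        by_contra hcon
        exact hn ⟨le_of_lt hr, not_lt.1 hcon⟩
      have h3 : fderiv ℝ φ (r • TT (cos θ, sin θ) + a) = 0 := by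
        have := mt (tsupport_fderiv_subset ℝ (f := φ) ·) (hvan r θ this)
        exact image_eq_zero_of_notMem_tsupport this
      simp [h3]
    · refine tendsto_const_nhds.congr' ?_
      filter_upwards [Filter.eventually_gt_atTop (R0 + ‖a‖)] with r hr
      exact (image_eq_zero_of_notMem_tsupport (hvan r θ hr)).symm
  simp only [inner_eq]
  simp
  left
  rw [max_eq_left (by positivity)]
  ring

open scoped Convolution

/-- mollification -/
noncomputable def moll (ρ : ContDiffBump (0 : E2)) (W : E2 → E2) : E2 → E2 :=
  (ρ.normed volume) ⋆[ContinuousLinearMap.lsmul ℝ ℝ, volume] W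

lemma moll_norm_le (ρ : ContDiffBump (0 : E2)) (W : E2 → E2) (hW : Integrable W) :
    ∫ x, ‖moll ρ W x‖ ≤ ∫ x, ‖W x‖ := by
  have h1 : ∀ x, ‖moll ρ W x‖ ≤ ((ρ.normed volume) ⋆[ContinuousLinearMap.lsmul ℝ ℝ, volume] (fun y => ‖W y‖)) x := by
    intro x
    simp only [moll, convolution_def, ContinuousLinearMap.lsmul_apply]
    refine (norm_integral_le_integral_norm _).trans_eq ?_
    congr 1 with t
    rw [norm_smul, norm_of_nonneg (ρ.nonneg_normed t), smul_eq_mul]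
  have h2 := integral_convolution (ContinuousLinearMap.lsmul ℝ ℝ) (ρ.integrable_normed (μ := volume)) hW.norm (μ := volume)
  rw [ρ.integral_normed] at h2
  simp only [ContinuousLinearMap.lsmul_apply, one_smul] at h2
  rw [← h2]
  refine integral_mono_of_nonneg (Filter.Eventually.of_forall fun x => norm_nonneg _) ?_ (Filter.Eventually.of_forall h1)
  exact (ρ.integrable_normed (μ := volume)).integrable_convolution _ hW.norm

lemma moll_integrable (ρ : ContDiffBump (0 : E2)) (W : E2 → E2) (hW : Integrable W) :
    Integrable (moll ρ W) :=
  (ρ.integrable_normed (μ := volume)).integrable_convolution _ hW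

lemma moll_sub (ρ : ContDiffBump (0 : E2)) (W g : E2 → E2) (hW : Integrable W) (hg : Integrable g) (x : E2) :
    moll ρ W x - moll ρ g x = moll ρ (fun y => W y - g y) x := by
  simp only [moll, convolution_def]
  have hw := ρ.hasCompactSupport_normed (μ := volume).convolutionExists_left (ContinuousLinearMap.lsmul ℝ ℝ) ρ.continuous_normed hW.locallyIntegrable x
  have hg := ρ.hasCompactSupport_normed (μ := volume).convolutionExists_left (ContinuousLinearMap.lsmul ℝ ℝ) ρ.continuous_normed hg.locallyIntegrable x
  rw [← integral_sub hw hg]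
  simp [smul_sub]

lemma moll_tendsto (ρ : ℕ → ContDiffBump (0 : E2)) (hρ : Filter.Tendsto (fun k => (ρ k).rOut) Filter.atTop (nhds 0))
    (W : E2 → E2) (hW : Integrable W) :
    Filter.Tendsto (fun k => ∫ x, ‖moll (ρ k) W x - W x‖) Filter.atTop (nhds 0) := by
  rw [Metric.tendsto_atTop]
  intro δ hδ
  obtain ⟨g, hgc, hgW, hgcont, hgi⟩ := hW.exists_hasCompactSupport_integral_sub_le (show 0 < δ / 4 by positivity)
  set K := cthickening 1 (tsupport g) with hK
  have hKc : IsCompact K := hgc.isCompact.cthickening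
  set M := volume.real K
  have hM : 0 ≤ M := measureReal_nonneg
  obtain ⟨η, hη, hηM⟩ : ∃ η > 0, η * M < δ / 4 := by
    refine ⟨δ / 4 / (M + 1), by positivity, ?_⟩
    rw [div_mul_eq_mul_div, div_lt_iff₀ (by positivity)]
    nlinarith
  have huc := hgc.uniformContinuous_of_continuous hgcont
  rw [Metric.uniformContinuous_iff] at huc
  obtain ⟨s, hs, hsg⟩ := huc η hη
  have hev : ∀ᶠ k in Filter.atTop, (ρ k).rOut < min s 1 := hρ.eventually_lt_const (by positivity)
  obtain ⟨k0, hk0⟩ := Filter.eventually_atTop.1 hev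
  refine ⟨k0, fun k hk => ?_⟩
  have hk1 := hk0 k hk
  have hs1 : (ρ k).rOut < s := hk1.trans_le (min_le_left _ _)
  have hs2 : (ρ k).rOut < 1 := hk1.trans_le (min_le_right _ _)
  have hb : ∀ x, ‖moll (ρ k) g x - g x‖ ≤ K.indicator (fun _ => η) x := by
    intro x
    rw [← dist_eq_norm]
    by_cases hx : x ∈ K
    · rw [Set.indicator_of_mem hx]
      refine (ρ k).dist_normed_convolution_le hgcont.aestronglyMeasurable ?_
      intro y hy
      exact (hsg ((mem_ball.1 hy).trans hs1)).le
    · rw [Set.indicator_of_notMem hx]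
      refine (ρ k).dist_normed_convolution_le hgcont.aestronglyMeasurable ?_
      intro y hy
      have h1 : ∀ z, dist z x ≤ 1 → g z = 0 := by
        intro z hz
        refine image_eq_zero_of_notMem_tsupport fun hz2 => hx ?_
        exact mem_cthickening_of_dist_le x z 1 _ hz2 (by rwa [dist_comm])
      rw [h1 y ((mem_ball.1 hy).trans hs2).le, h1 x (by simp)]
      simp
  have hgi2 : Integrable (fun x => ‖moll (ρ k) g x - g x‖) := ((moll_integrable _ _ hgi).sub hgi).norm
  have hint1 : ∫ x, ‖moll (ρ k) g x - g x‖ ≤ η * M := by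
    calc ∫ x, ‖moll (ρ k) g x - g x‖ ≤ ∫ x, K.indicator (fun _ => η) x := by
          refine integral_mono hgi2 ?_ hb
          exact (integrable_indicator_iff hKc.measurableSet).2 (integrableOn_const hKc.measure_lt_top.ne)
      _ = η * M := by
          rw [integral_indicator hKc.measurableSet, setIntegral_const, smul_eq_mul, mul_comm]
  have hsubi : Integrable (fun y => W y - g y) := hW.sub hgi
  have hint2 := (moll_norm_le (ρ k) _ hsubi).trans hgW
  have htot : ∫ x, ‖moll (ρ k) W x - W x‖ ≤ ∫ x, (‖moll (ρ k) (fun y => W y - g y) x‖ + ‖moll (ρ k) g x - g x‖ + ‖W x - g x‖) := by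
    refine integral_mono ((moll_integrable _ _ hW).sub hW).norm (((moll_integrable _ _ hsubi).norm.add hgi2).add hsubi.norm) ?_
    intro x
    simp only
    rw [← moll_sub _ _ _ hW hgi]
    calc ‖moll (ρ k) W x - W x‖ = ‖(moll (ρ k) W x - moll (ρ k) g x) + (moll (ρ k) g x - g x) - (W x - g x)‖ := by
          congr 1; abel
      _ ≤ _ := (norm_sub_le _ _).trans (by gcongr; exact norm_add_le _ _)
  rw [integral_add (f := fun x => ‖moll (ρ k) (fun y => W y - g y) x‖ + ‖moll (ρ k) g x - g x‖) ((moll_integrable _ _ hsubi).norm.add hgi2) hsubi.norm, integral_add (moll_integrable _ _ hsubi).norm hgi2] at htot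
  rw [dist_zero_right, norm_of_nonneg (integral_nonneg fun x => norm_nonneg _)]
  linarith

lemma moll_deriv (ρ : ContDiffBump (0 : E2)) (W : E2 → E2) (hW : Integrable W) (x : E2) :
    ∃ D : E2 →L[ℝ] E2, HasFDerivAt (moll ρ W) D x ∧
      ∀ a b, Integrable (fun t => fderiv ℝ (ρ.normed volume) (x - t) a * ⟪W t, b⟫) ∧
        ⟪D a, b⟫ = ∫ t, fderiv ℝ (ρ.normed volume) (x - t) a * ⟪W t, b⟫ := by
  have hcd : ContDiff ℝ 1 (ρ.normed (volume : Measure E2)) := ρ.contDiff_normed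
  have hcs := ρ.hasCompactSupport_normed (μ := (volume : Measure E2))
  have h := hcs.hasFDerivAt_convolution_left (ContinuousLinearMap.lsmul ℝ ℝ) hcd hW.locallyIntegrable (μ := volume) x
  refine ⟨_, h, fun a b => ?_⟩
  have hex := (hcs.fderiv ℝ).convolutionExists_left (ContinuousLinearMap.precompL E2 (ContinuousLinearMap.lsmul ℝ ℝ : ℝ →L[ℝ] E2 →L[ℝ] E2)) (hcd.continuous_fderiv (by norm_num)) hW.locallyIntegrable (μ := volume) x
  have hex2 := hex.integrable_swap
  rw [convolution_eq_swap]
  have hab : Integrable (fun t => ⟪(((ContinuousLinearMap.precompL E2 (ContinuousLinearMap.lsmul ℝ ℝ : ℝ →L[ℝ] E2 →L[ℝ] E2)) (fderiv ℝ (ρ.normed volume) (x - t))) (W t)) a, b⟫) := 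
    (hex2.apply_continuousLinearMap a).inner_const b
  have heq : ∀ t, ⟪(((ContinuousLinearMap.precompL E2 (ContinuousLinearMap.lsmul ℝ ℝ : ℝ →L[ℝ] E2 →L[ℝ] E2)) (fderiv ℝ (ρ.normed volume) (x - t))) (W t)) a, b⟫ = fderiv ℝ (ρ.normed volume) (x - t) a * ⟪W t, b⟫ := by
    intro t
    simp [ContinuousLinearMap.precompL, inner_smul_left]
  simp only [heq] at hab
  refine ⟨hab, ?_⟩
  rw [ContinuousLinearMap.integral_apply hex2, real_inner_comm, ← integral_inner (hex2.apply_continuousLinearMap a)]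
  congr 1 with t
  rw [real_inner_comm, heq]

lemma moll_continuous (ρ : ContDiffBump (0 : E2)) (W : E2 → E2) (hW : Integrable W) : Continuous (moll ρ W) := by
  rw [continuous_iff_continuousAt]
  intro x
  obtain ⟨D, hD, -⟩ := moll_deriv ρ W hW x
  exact hD.continuousAt

lemma moll_potential (ρ : ContDiffBump (0 : E2)) (W : E2 → E2) (hW : Integrable W) (r : ℝ)
    (hr : r + ρ.rOut ≤ 1)
    (hcurl : ∀ φ : E2 → ℝ, ContDiff ℝ (⊤ : ℕ∞) φ →
      HasCompactSupport φ → tsupport φ ⊆ ball (0 : E2) 1 →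
      ∫ y, (W y 0 * fderiv ℝ φ y (EuclideanSpace.single 1 1) - W y 1 * fderiv ℝ φ y (EuclideanSpace.single 0 1)) = 0) :
    ∃ ψ : E2 → ℝ, ∀ x ∈ ball (0 : E2) r, HasFDerivAt ψ (innerSL ℝ (moll ρ W x)) x := by
  choose D hD hDi using moll_deriv ρ W hW
  have hω : ∀ x, HasFDerivAt (fun x => innerSL ℝ (moll ρ W x)) ((innerSL ℝ : E2 →L[ℝ] E2 →L[ℝ] ℝ).comp (D x)) x := by
    intro x
    exact (innerSL ℝ : E2 →L[ℝ] E2 →L[ℝ] ℝ).hasFDerivAt.comp x (hD x)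
  refine Convex.exists_forall_hasFDerivAt_of_fderiv_symmetric (convex_ball 0 r) isOpen_ball
    (fun x _ => (hω x).differentiableAt.differentiableWithinAt) ?_
  intro x hx a b
  rw [(hω x).fderiv]
  simp only [ContinuousLinearMap.comp_apply, innerSL_apply_apply]
  rw [(hDi x a b).2, (hDi x b a).2, ← sub_eq_zero, ← integral_sub (hDi x a b).1 (hDi x b a).1]
  set φ : E2 → ℝ := fun t => ρ.normed volume (x - t) with hφ
  have hφs : ContDiff ℝ (⊤ : ℕ∞) φ := ρ.contDiff_normed.comp (contDiff_const.sub contDiff_id)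
  have hts : tsupport φ ⊆ closedBall x ρ.rOut := by
    refine closure_minimal ?_ isClosed_closedBall
    intro t ht
    have : x - t ∈ Function.support (ρ.normed volume) := ht
    rw [ρ.support_normed_eq] at this
    rw [mem_closedBall, dist_comm, dist_eq_norm]
    simpa using (mem_ball_zero_iff.1 this).le
  have hcφ : HasCompactSupport φ :=
    (isCompact_closedBall x ρ.rOut).of_isClosed_subset (isClosed_tsupport _) hts
  have hsub : tsupport φ ⊆ ball (0 : E2) 1 := by
    refine hts.trans fun t ht => ?_
    rw [mem_ball_zero_iff] at hx ⊢
    rw [mem_closedBall, dist_eq_norm] at ht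
    have := norm_add_le x (t - x)
    rw [add_sub_cancel] at this
    linarith
  have hc := hcurl φ hφs hcφ hsub
  have hfd : ∀ t v, fderiv ℝ φ t v = - fderiv ℝ (ρ.normed volume) (x - t) v := by
    intro t v
    have h1 : HasFDerivAt (fun t : E2 => x - t) (-ContinuousLinearMap.id ℝ E2) t := (hasFDerivAt_id t).const_sub x
    have h2 : HasFDerivAt (ρ.normed volume) (fderiv ℝ (ρ.normed volume) (x - t)) (x - t) :=
      ((ρ.contDiff_normed (n := 1)).differentiable (by norm_num) _).hasFDerivAt
    have h3 : HasFDerivAt φ _ t := h2.comp t h1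
    rw [h3.fderiv]
    simp
  have hexp : ∀ v : E2, v = v 0 • EuclideanSpace.single 0 1 + v 1 • EuclideanSpace.single 1 1 := by
    intro v; ext i; fin_cases i <;> simp
  have hpt : ∀ t, fderiv ℝ (ρ.normed volume) (x - t) a * ⟪W t, b⟫ - fderiv ℝ (ρ.normed volume) (x - t) b * ⟪W t, a⟫
      = (a 0 * b 1 - a 1 * b 0) * (W t 0 * fderiv ℝ φ t (EuclideanSpace.single 1 1) - W t 1 * fderiv ℝ φ t (EuclideanSpace.single 0 1)) := by
    intro t
    rw [hfd, hfd]
    have ea := congrArg (fderiv ℝ (ρ.normed volume) (x - t)) (hexp a)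
    have eb := congrArg (fderiv ℝ (ρ.normed volume) (x - t)) (hexp b)
    rw [map_add, map_smul, map_smul, smul_eq_mul, smul_eq_mul] at ea eb
    rw [ea, eb]
    simp only [PiLp.inner_apply, Fin.sum_univ_two, RCLike.inner_apply, conj_trivial]
    ring
  simp only [hpt]
  rw [integral_const_mul, hc, mul_zero]


/-- integrand of the averaged homotopy operator -/
noncomputable def FF (W : E2 → E2) (x : E2) (q : ℝ × E2) : ℝ :=
  ⟪W ((1 - q.1) • q.2 + q.1 • x), x - q.2⟫

noncomputable def mu0 : Measure (ℝ × E2) :=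
  (volume.restrict (Set.Ioc (0:ℝ) 1)).prod (volume.restrict (ball (0 : E2) (1/2)))

/-- averaged homotopy operator -/
noncomputable def pot (W : E2 → E2) (x : E2) : ℝ :=
  (volume.real (ball (0 : E2) (1/2)))⁻¹ * ∫ q, FF W x q ∂mu0

instance : IsFiniteMeasure mu0 := by 
  unfold mu0
  rw [Measure.prod_restrict]
  refine ⟨?_⟩
  rw [Measure.restrict_apply_univ, Measure.prod_prod]
  exact ENNReal.mul_lt_top measure_Ioc_lt_top measure_ball_lt_top

lemma FF_measurable (W : E2 → E2) (hW : Measurable W) : Measurable (fun z : E2 × (ℝ × E2) => FF W z.1 z.2) := by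
  unfold FF
  refine Measurable.inner ?_ (by fun_prop)
  exact hW.comp (by fun_prop)

lemma pot_measurable (W : E2 → E2) (hW : Measurable W) : Measurable (pot W) := by
  have h := (FF_measurable W hW).stronglyMeasurable.integral_prod_right' (ν := mu0)
  exact h.measurable.const_mul _

lemma lint_affine (f : E2 → ℝ≥0∞) (hf : Measurable f) (t : ℝ) (ht : 1/2 ≤ t) (a : E2) :
    ∫⁻ b, f (t • b + a) ≤ 4 * ∫⁻ b, f b := by
  have h1 : ∫⁻ b, f (t • b + a) = ∫⁻ c, f (c + a) ∂(Measure.map (fun b : E2 => t • b) volume) := by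
    rw [lintegral_map (by fun_prop) (by fun_prop)]
  have ht0 : 0 < t := by linarith
  rw [h1, Measure.map_addHaar_smul volume ht0.ne', lintegral_smul_measure, lintegral_add_right_eq_self]
  simp only [smul_eq_mul, finrank_euclideanSpace_fin]
  gcongr
  rw [show (4 : ℝ≥0∞) = ENNReal.ofReal 4 by norm_num]
  apply ENNReal.ofReal_le_ofReal
  rw [abs_of_pos (by positivity), inv_le_comm₀ (by positivity) (by norm_num)]
  nlinarith

lemma lint_bound (f : E2 → ℝ≥0∞) (hf : Measurable f) :
    ∫⁻ x in ball (0 : E2) 1, ∫⁻ q, f ((1 - q.1) • q.2 + q.1 • x) ∂mu0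
      ≤ volume (ball (0 : E2) 1) * (4 * ∫⁻ b, f b) := by
  have hm : Measurable (fun z : E2 × (ℝ × E2) => f ((1 - z.2.1) • z.2.2 + z.2.1 • z.1)) := by fun_prop
  have hm1 : Measurable (fun z : ℝ × E2 => ∫⁻ x in ball (0 : E2) 1, f ((1 - z.1) • z.2 + z.1 • x)) :=
    Measurable.lintegral_prod_left' (f := fun z : E2 × (ℝ × E2) => f ((1 - z.2.1) • z.2.2 + z.2.1 • z.1)) hm
  rw [lintegral_lintegral_swap hm.aemeasurable]
  rw [mu0, lintegral_prod _ hm1.aemeasurable]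
  have hle : volume (ball (0 : E2) (1/2)) ≤ volume (ball (0 : E2) 1) :=
    measure_mono (ball_subset_ball (by norm_num))
  have key : ∀ t ∈ Set.Ioc (0:ℝ) 1, ∫⁻ b in ball (0 : E2) (1/2), ∫⁻ x in ball (0 : E2) 1, f ((1 - t) • b + t • x)
      ≤ volume (ball (0 : E2) 1) * (4 * ∫⁻ b, f b) := by
    intro t ht
    rcases le_total (1/2) t with h | h
    · calc ∫⁻ b in ball (0 : E2) (1/2), ∫⁻ x in ball (0 : E2) 1, f ((1 - t) • b + t • x)
          ≤ ∫⁻ b in ball (0 : E2) (1/2), (4 * ∫⁻ b, f b) := by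
            refine lintegral_mono fun b => (setLIntegral_le_lintegral _ _).trans ?_
            simp only [add_comm ((1 - t) • b)]
            exact lint_affine f hf t h _
        _ ≤ _ := by
            rw [setLIntegral_const, mul_comm]
            gcongr
    · have hm2 : Measurable (fun z : E2 × E2 => f ((1 - t) • z.1 + t • z.2)) := by fun_prop
      rw [lintegral_lintegral_swap hm2.aemeasurable]
      calc ∫⁻ x in ball (0 : E2) 1, ∫⁻ b in ball (0 : E2) (1/2), f ((1 - t) • b + t • x)
          ≤ ∫⁻ x in ball (0 : E2) 1, (4 * ∫⁻ b, f b) := by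
            refine lintegral_mono fun b => (setLIntegral_le_lintegral _ _).trans ?_
            exact lint_affine f hf (1 - t) (by linarith) _
        _ ≤ _ := by
            rw [setLIntegral_const, mul_comm]
  calc _ ≤ ∫⁻ t in Set.Ioc (0:ℝ) 1, volume (ball (0 : E2) 1) * (4 * ∫⁻ b, f b) :=
        setLIntegral_mono' measurableSet_Ioc key
    _ = _ := by rw [setLIntegral_const]; simp

lemma FF_enorm_le (W : E2 → E2) (x : E2) (hx : x ∈ ball (0 : E2) 1) :
    ∀ᵐ q ∂mu0, ‖FF W x q‖ₑ ≤ 2 * ‖W ((1 - q.1) • q.2 + q.1 • x)‖ₑ := by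
  have h : ∀ᵐ q ∂mu0, q.2 ∈ ball (0 : E2) (1/2) := by
    rw [mu0, Measure.prod_restrict]
    filter_upwards [ae_restrict_mem (measurableSet_Ioc.prod measurableSet_ball)] with q hq
    exact hq.2
  filter_upwards [h] with q hq
  rw [mem_ball_zero_iff] at hx hq
  have h1 : ‖x - q.2‖ ≤ 2 := (norm_sub_le _ _).trans (by linarith)
  have h2 : ‖FF W x q‖ ≤ 2 * ‖W ((1 - q.1) • q.2 + q.1 • x)‖ := by
    refine (norm_inner_le_norm _ _).trans ?_
    nlinarith [norm_nonneg (W ((1 - q.1) • q.2 + q.1 • x))]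
  have h3 := ENNReal.ofReal_le_ofReal h2
  rw [ENNReal.ofReal_mul (by norm_num), ofReal_norm, ofReal_norm] at h3
  simpa using h3

lemma FF_bound (W : E2 → E2) (hW : Measurable W) :
    ∫⁻ x in ball (0 : E2) 1, ∫⁻ q, ‖FF W x q‖ₑ ∂mu0
      ≤ 2 * (volume (ball (0 : E2) 1) * (4 * ∫⁻ b, ‖W b‖ₑ)) := by
  have hm : Measurable (fun z : E2 × (ℝ × E2) => ‖W ((1 - z.2.1) • z.2.2 + z.2.1 • z.1)‖ₑ) :=
    (hW.comp (by fun_prop)).enorm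
  have hm1 : Measurable (fun x : E2 => ∫⁻ q, ‖W ((1 - q.1) • q.2 + q.1 • x)‖ₑ ∂mu0) :=
    Measurable.lintegral_prod_right' (f := fun z : E2 × (ℝ × E2) => ‖W ((1 - z.2.1) • z.2.2 + z.2.1 • z.1)‖ₑ) hm
  calc ∫⁻ x in ball (0 : E2) 1, ∫⁻ q, ‖FF W x q‖ₑ ∂mu0
      ≤ ∫⁻ x in ball (0 : E2) 1, 2 * ∫⁻ q, ‖W ((1 - q.1) • q.2 + q.1 • x)‖ₑ ∂mu0 := by
        refine setLIntegral_mono' measurableSet_ball fun x hx => ?_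
        have hmx : Measurable (fun q : ℝ × E2 => ‖W ((1 - q.1) • q.2 + q.1 • x)‖ₑ) := (hW.comp (by fun_prop)).enorm
        rw [← lintegral_const_mul _ hmx]
        exact lintegral_mono_ae (FF_enorm_le W x hx)
    _ = 2 * ∫⁻ x in ball (0 : E2) 1, ∫⁻ q, ‖W ((1 - q.1) • q.2 + q.1 • x)‖ₑ ∂mu0 :=
        lintegral_const_mul _ hm1
    _ ≤ _ := by
        gcongr
        exact lint_bound (fun y => ‖W y‖ₑ) hW.enorm

lemma FF_integrable (W : E2 → E2) (hW : Measurable W) (hWi : Integrable W) :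
    ∀ᵐ x ∂(volume.restrict (ball (0 : E2) 1)), Integrable (FF W x) mu0 := by
  have h := FF_bound W hW
  have hlt : ∫⁻ x in ball (0 : E2) 1, ∫⁻ q, ‖FF W x q‖ₑ ∂mu0 ≠ ∞ := by
    refine (h.trans_lt ?_).ne
    have h1 : ∫⁻ b, ‖W b‖ₑ < ∞ := hWi.2
    have h2 : volume (ball (0 : E2) 1) < ∞ := measure_ball_lt_top
    exact ENNReal.mul_lt_top (by norm_num) (ENNReal.mul_lt_top h2 (ENNReal.mul_lt_top (by norm_num) h1))
  have hm : Measurable (fun x => ∫⁻ q, ‖FF W x q‖ₑ ∂mu0) := (FF_measurable W hW).enorm.lintegral_prod_right'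
  filter_upwards [ae_lt_top hm hlt] with x hx
  exact ⟨((FF_measurable W hW).comp measurable_prodMk_left).aestronglyMeasurable, hx⟩

lemma pot_sub_bound (W U : E2 → E2) (hW : Measurable W) (hWi : Integrable W) (hU : Measurable U) (hUi : Integrable U) :
    eLpNorm (pot U - pot W) 1 (volume.restrict (ball (0 : E2) 1)) ≤
      ‖(volume.real (ball (0 : E2) (1/2)))⁻¹‖ₑ * (2 * (volume (ball (0 : E2) 1) * (4 * ∫⁻ b, ‖U b - W b‖ₑ))) := by
  rw [eLpNorm_one_eq_lintegral_enorm]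
  have hm : Measurable (fun x => ∫⁻ q, ‖FF (fun y => U y - W y) x q‖ₑ ∂mu0) := (FF_measurable _ (hU.sub hW)).enorm.lintegral_prod_right'
  calc _ ≤ ∫⁻ x in ball (0 : E2) 1, ‖(volume.real (ball (0 : E2) (1/2)))⁻¹‖ₑ * ∫⁻ q, ‖FF (fun y => U y - W y) x q‖ₑ ∂mu0 := by
        refine lintegral_mono_ae ?_
        filter_upwards [FF_integrable W hW hWi, FF_integrable U hU hUi] with x h1 h2
        rw [Pi.sub_apply, pot, pot, ← mul_sub, ← integral_sub h2 h1, enorm_mul]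
        gcongr
        refine (enorm_integral_le_lintegral_enorm _).trans_eq ?_
        congr 1 with q
        simp only [FF, inner_sub_left]
    _ = _ := lintegral_const_mul _ hm
    _ ≤ _ := by
        gcongr
        exact FF_bound _ (hU.sub hW)

lemma pot_eq (W : E2 → E2) (hW : Continuous W) (r : ℝ) (hr : 1/2 < r) (ψ : E2 → ℝ)
    (hψ : ∀ x ∈ ball (0 : E2) r, HasFDerivAt ψ (innerSL ℝ (W x)) x) :
    ∃ c, ∀ x ∈ ball (0 : E2) r, pot W x = ψ x - c := by
  refine ⟨(volume.real (ball (0 : E2) (1/2)))⁻¹ * ∫ b in ball (0 : E2) (1/2), ψ b, fun x hx => ?_⟩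
  have hFc : Continuous (FF W x) := by unfold FF; fun_prop
  have hFi : Integrable (FF W x) mu0 := by
    rw [mu0, Measure.prod_restrict]
    refine IntegrableOn.mono_set (hFc.continuousOn.integrableOn_compact (isCompact_Icc.prod (isCompact_closedBall (0:E2) (1/2))))
      (Set.prod_mono Set.Ioc_subset_Icc_self ball_subset_closedBall)
  have hψi : IntegrableOn ψ (ball (0 : E2) (1/2)) := by
    have hco : ContinuousOn ψ (closedBall (0:E2) (1/2)) := fun y hy =>
      (hψ y (closedBall_subset_ball hr hy)).continuousAt.continuousWithinAt
    exact IntegrableOn.mono_set (hco.integrableOn_compact (isCompact_closedBall (0:E2) (1/2))) ball_subset_closedBall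
  have hin : ∀ b ∈ ball (0 : E2) (1/2), ∫ t in Set.Ioc (0:ℝ) 1, FF W x (t, b) = ψ x - ψ b := by
    intro b hb
    rw [← intervalIntegral.integral_of_le zero_le_one]
    have hbr : b ∈ ball (0 : E2) r := ball_subset_ball hr.le hb
    have := intervalIntegral.integral_eq_sub_of_hasDerivAt (a := 0) (b := 1) (f := fun t : ℝ => ψ ((1 - t) • b + t • x)) (f' := fun t => FF W x (t, b)) ?_ ?_
    · simpa using this
    · intro t ht
      rw [Set.uIcc_of_le zero_le_one] at ht
      have hmem : (1 - t) • b + t • x ∈ ball (0 : E2) r :=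
        (convex_ball (0:E2) r) hbr hx (by linarith [ht.2]) ht.1 (by ring)
      have h1 : HasDerivAt (fun t : ℝ => (1 - t) • b + t • x) (x - b) t := by
        have := (((hasDerivAt_id t).const_sub 1).smul_const b).add ((hasDerivAt_id t).smul_const x)
        refine this.congr_deriv ?_
        simp; abel
      exact ((hψ _ hmem).comp_hasDerivAt t h1)
    · exact Continuous.intervalIntegrable (by fun_prop) _ _
  have hvol : volume.real (ball (0 : E2) (1/2)) ≠ 0 := by
    rw [measureReal_def, ENNReal.toReal_ne_zero]
    exact ⟨(measure_ball_pos _ _ (by norm_num)).ne', measure_ball_lt_top.ne⟩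
  have hcon : Integrable (fun _ : E2 => ψ x) (volume.restrict (ball (0 : E2) (1/2))) :=
    integrableOn_const measure_ball_lt_top.ne
  rw [pot, mu0, integral_prod_symm _ hFi, setIntegral_congr_fun measurableSet_ball hin,
    integral_sub hcon hψi, setIntegral_const, smul_eq_mul]
  field_simp

lemma exists_pot (W : E2 → E2) (hWm : Measurable W) (hW : Integrable W) (r : ℝ) (hr : 1/2 < r) (hr1 : r < 1)
    (hcurl : ∀ φ : E2 → ℝ, ContDiff ℝ (⊤ : ℕ∞) φ →
      HasCompactSupport φ → tsupport φ ⊆ ball (0 : E2) 1 →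
      ∫ y, (W y 0 * fderiv ℝ φ y (EuclideanSpace.single 1 1) - W y 1 * fderiv ℝ φ y (EuclideanSpace.single 0 1)) = 0) :
    ∃ (P : ℕ → E2 → ℝ) (U : ℕ → E2 → E2), (∀ k, Measurable (P k)) ∧ (∀ k, Continuous (U k)) ∧ (∀ k, Integrable (U k)) ∧
      (∀ k, ∀ x ∈ ball (0 : E2) r, HasFDerivAt (P k) (innerSL ℝ (U k x)) x) ∧
      Filter.Tendsto (fun k => ∫ x, ‖U k x - W x‖) Filter.atTop (nhds 0) ∧
      ∀ᵐ x ∂(volume.restrict (ball (0 : E2) 1)), Filter.Tendsto (fun k => P k x) Filter.atTop (nhds (pot W x)) := by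
  have hpos : ∀ k : ℕ, 0 < (1 - r) / (k + 1) := fun k => div_pos (by linarith) (by positivity)
  let ρ : ℕ → ContDiffBump (0 : E2) := fun k => ⟨(1 - r) / (k + 1) / 2, (1 - r) / (k + 1), half_pos (hpos k), half_lt_self (hpos k)⟩
  have hρ : Filter.Tendsto (fun k => (ρ k).rOut) Filter.atTop (nhds 0) := by
    have := tendsto_one_div_add_atTop_nhds_zero_nat (𝕜 := ℝ) |>.const_mul (1 - r)
    simp only [mul_zero, mul_one_div] at this
    exact this
  have hρ1 : ∀ k, r + (ρ k).rOut ≤ 1 := by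
    intro k
    have : (1 - r) / ((k:ℝ) + 1) ≤ 1 - r := div_le_self (by linarith) (by have := k.cast_nonneg (α := ℝ); linarith)
    change r + (1 - r) / ((k:ℝ) + 1) ≤ 1
    linarith
  have hU0 := moll_tendsto ρ hρ W hW
  have hUm : ∀ k, Measurable (moll (ρ k) W) := fun k => (moll_continuous (ρ k) W hW).measurable
  have hUi : ∀ k, Integrable (moll (ρ k) W) := fun k => moll_integrable (ρ k) W hW
  have hmeas : TendstoInMeasure (volume.restrict (ball (0 : E2) 1)) (fun k => pot (moll (ρ k) W)) Filter.atTop (pot W) := by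
    refine tendstoInMeasure_of_tendsto_eLpNorm one_ne_zero (fun k => (pot_measurable _ (hUm k)).aestronglyMeasurable)
      (pot_measurable _ hWm).aestronglyMeasurable ?_
    refine tendsto_of_tendsto_of_tendsto_of_le_of_le tendsto_const_nhds ?_ (fun _ => bot_le)
      (fun k => pot_sub_bound W (moll (ρ k) W) hWm hW (hUm k) (hUi k))
    have h1 : Filter.Tendsto (fun k => ∫⁻ b, ‖moll (ρ k) W b - W b‖ₑ) Filter.atTop (nhds 0) := by
      have h2 : ∀ k, ∫⁻ b, ‖moll (ρ k) W b - W b‖ₑ = ENNReal.ofReal (∫ b, ‖moll (ρ k) W b - W b‖) := fun k =>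
        (ofReal_integral_norm_eq_lintegral_enorm ((hUi k).sub hW)).symm
      simp only [h2]
      simpa using ENNReal.tendsto_ofReal hU0
    have hv : volume (ball (0 : E2) 1) ≠ ∞ := measure_ball_lt_top.ne
    have h3 := ENNReal.Tendsto.const_mul h1 (a := 4) (Or.inr (by norm_num))
    have h4 := ENNReal.Tendsto.const_mul h3 (a := volume (ball (0 : E2) 1)) (Or.inr hv)
    have h5 := ENNReal.Tendsto.const_mul h4 (a := 2) (Or.inr (by norm_num))
    have h6 := ENNReal.Tendsto.const_mul h5 (a := ‖(volume.real (ball (0 : E2) (1/2)))⁻¹‖ₑ) (Or.inr (by simp))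
    simpa using h6
  obtain ⟨ns, hns, hae⟩ := hmeas.exists_seq_tendsto_ae
  refine ⟨fun k => pot (moll (ρ (ns k)) W), fun k => moll (ρ (ns k)) W, fun k => pot_measurable _ (hUm _), fun k => moll_continuous _ W hW,
    fun k => hUi _, ?_, hU0.comp hns.tendsto_atTop, hae⟩
  intro k x hx
  obtain ⟨ψ, hψ⟩ := moll_potential (ρ (ns k)) W hW r (hρ1 _) hcurl
  obtain ⟨c, hc⟩ := pot_eq _ (moll_continuous _ W hW) r hr ψ hψ
  refine ((hψ x hx).sub_const c).congr_of_eventuallyEq ?_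
  filter_upwards [isOpen_ball.mem_nhds hx] with y hy
  exact hc y hy


/-- complex coordinate -/
noncomputable def zz (y : E2) : ℂ := (y 0 : ℂ) + (y 1 : ℂ) * Complex.I

/-- basic vortex -/
noncomputable def vort (a y : E2) : ℂ := zz (y - a) / (‖y - a‖ : ℂ)

/-- its current -/
noncomputable def KK (a y : E2) : E2 := (‖y - a‖ ^ 2)⁻¹ • !₂[-(y - a) 1, (y - a) 0]

lemma zz_norm (y : E2) : ‖zz y‖ = ‖y‖ := by
  rw [zz, Complex.norm_add_mul_I, EuclideanSpace.norm_eq]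
  simp [Fin.sum_univ_two]

lemma vort_norm (a y : E2) (h : y ≠ a) : ‖vort a y‖ = 1 := by
  have : ‖y - a‖ ≠ 0 := norm_ne_zero_iff.2 (sub_ne_zero.2 h)
  rw [vort, norm_div, zz_norm, Complex.norm_real, norm_norm, div_self this]

lemma vort_zpow_norm_le (a y : E2) (m : ℤ) : ‖vort a y ^ m‖ ≤ 1 := by
  by_cases h : y = a
  · subst h
    rcases eq_or_ne m 0 with rfl | hm
    · simp
    · simp [vort, zero_zpow m hm]
  · rw [norm_zpow, vort_norm a y h, one_zpow]

lemma vort_measurable (a : E2) : Measurable (vort a) := by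
  unfold vort zz
  fun_prop

lemma KK_measurable (a : E2) : Measurable (KK a) := by
  have h1 : Measurable (fun y : E2 => (!₂[-(y - a) 1, (y - a) 0] : E2)) :=
    Continuous.measurable (by fun_prop)
  unfold KK
  fun_prop

lemma KK_norm_le (a y : E2) : ‖KK a y‖ ≤ ‖y - a‖⁻¹ := by
  have h1 : ‖(!₂[-(y - a) 1, (y - a) 0] : E2)‖ = ‖y - a‖ := by
    simp [EuclideanSpace.norm_eq, Fin.sum_univ_two, add_comm]
    congr 1; ring
  rw [KK, norm_smul, h1]
  rcases eq_or_ne y a with rfl | h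
  · simp
  have : ‖y - a‖ ≠ 0 := norm_ne_zero_iff.2 (sub_ne_zero.2 h)
  rw [norm_inv, norm_pow, norm_norm]
  apply le_of_eq
  field_simp

lemma KK_locInt (a : E2) : LocallyIntegrable (KK a) := by
  refine (locInt_inv_norm a).mono (KK_measurable a).aestronglyMeasurable (Filter.Eventually.of_forall fun y => ?_)
  rw [norm_inv, norm_norm]
  exact KK_norm_le a y

lemma vort_deriv (a y v : E2) (h : y ≠ a) :
    HasLineDerivAt ℝ (vort a) (Complex.I * (⟪KK a y, v⟫ : ℝ) * vort a y) y v := by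
  unfold HasLineDerivAt
  have hn : ‖y - a‖ ≠ 0 := norm_ne_zero_iff.2 (sub_ne_zero.2 h)
  have hw : HasDerivAt (fun t : ℝ => y + t • v - a) v 0 := by
    simpa using (((hasDerivAt_id (0:ℝ)).smul_const v).const_add y).sub_const a
  have hN := hw.norm_sq
  have hS := hN.sqrt (by simpa using hn)
  simp only [Real.sqrt_sq (norm_nonneg _)] at hS
  have hS2 := hS.ofReal_comp
  have hz : HasDerivAt (fun t : ℝ => zz (y + t • v - a)) (zz v) 0 := by
    have e : ∀ t : ℝ, zz (y + t • v - a) = zz (y - a) + (t : ℂ) * zz v := by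
      intro t
      simp [zz]
      ring
    simp only [e]
    have := ((hasDerivAt_id (0:ℝ)).ofReal_comp.mul_const (zz v)).const_add (zz (y - a))
    simpa using this
  have := hz.div hS2 (by simpa using hn)
  unfold vort
  refine this.congr_deriv ?_
  have hnc : (‖y - a‖ : ℂ) ≠ 0 := by exact_mod_cast hn
  have hsq : (‖y - a‖ : ℂ) ^ 2 = ((y - a) 0 : ℂ) ^ 2 + ((y - a) 1 : ℂ) ^ 2 := by
    have : ‖y - a‖ ^ 2 = (y - a) 0 ^ 2 + (y - a) 1 ^ 2 := by
      simp [EuclideanSpace.norm_sq_eq, Fin.sum_univ_two]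
    exact_mod_cast this
  simp only [zero_smul, add_zero, KK, PiLp.inner_apply, Fin.sum_univ_two, RCLike.inner_apply, conj_trivial, PiLp.smul_apply, smul_eq_mul]
  generalize y - a = w at *
  generalize ‖w‖ = N at *
  simp only [zz, Matrix.cons_val_zero, Matrix.cons_val_one]
  push_cast
  field_simp
  have hI := Complex.I_sq
  linear_combination ((v 0 : ℂ) + (v 1 : ℂ) * Complex.I) * hsq
    - (w 1 : ℂ) * (-((v 0 : ℂ) * (w 1 : ℂ)) + (v 1 : ℂ) * (w 0 : ℂ)) * hI

lemma vort_zpow_deriv (a y v : E2) (m : ℤ) (h : y ≠ a) :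
    HasLineDerivAt ℝ (fun y => vort a y ^ m) (Complex.I * ((m * ⟪KK a y, v⟫ : ℝ) : ℂ) * vort a y ^ m) y v := by
  have h1 := vort_deriv a y v h
  have h0 : vort a y ≠ 0 := norm_ne_zero_iff.1 (by rw [vort_norm a y h]; norm_num)
  unfold HasLineDerivAt at h1 ⊢
  have h2 : HasDerivAt (fun z : ℂ => z ^ m) (m * vort a (y + (0:ℝ) • v) ^ (m - 1)) (vort a (y + (0:ℝ) • v)) :=
    hasDerivAt_zpow m _ (Or.inl (by simpa using h0))
  have h3 := h2.scomp (0:ℝ) h1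
  refine h3.congr_deriv ?_
  simp only [zero_smul, add_zero, smul_eq_mul]
  rw [zpow_sub_one₀ h0]
  push_cast
  field_simp

/-- product of vortices -/
noncomputable def u0 {N : ℕ} (x : Fin N → E2) (n : Fin N → ℤ) (y : E2) : ℂ := ∏ i, vort (x i) y ^ n i

/-- current of product -/
noncomputable def CC {N : ℕ} (x : Fin N → E2) (n : Fin N → ℤ) (y : E2) : E2 := ∑ i, (n i : ℝ) • KK (x i) y

lemma prod_line_deriv {ι : Type*} (s : Finset ι) (f : ι → E2 → ℂ) (k : ι → ℝ) (y v : E2)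
    (h : ∀ i ∈ s, HasLineDerivAt ℝ (f i) (Complex.I * (k i : ℂ) * f i y) y v) :
    HasLineDerivAt ℝ (fun y => ∏ i ∈ s, f i y) (Complex.I * ((∑ i ∈ s, k i : ℝ) : ℂ) * ∏ i ∈ s, f i y) y v := by
  classical
  induction s using Finset.induction_on with
  | empty =>
    unfold HasLineDerivAt
    simpa using hasDerivAt_const (0:ℝ) (1:ℂ)
  | insert i s hi ih =>
    have h1 := h i (Finset.mem_insert_self i s)
    have h2 := ih fun j hj => h j (Finset.mem_insert_of_mem hj)
    unfold HasLineDerivAt at h1 h2 ⊢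
    have h3 := h1.mul h2
    simp only [Finset.prod_insert hi, Finset.sum_insert hi]
    refine h3.congr_deriv ?_
    simp only [zero_smul, add_zero]
    push_cast
    ring

lemma u0_deriv {N : ℕ} (x : Fin N → E2) (n : Fin N → ℤ) (y v : E2) (hy : y ∉ Set.range x) :
    HasLineDerivAt ℝ (u0 x n) (Complex.I * (⟪CC x n y, v⟫ : ℝ) * u0 x n y) y v := by
  have := prod_line_deriv Finset.univ (fun i y => vort (x i) y ^ n i) (fun i => n i * ⟪KK (x i) y, v⟫) y v
    (fun i _ => vort_zpow_deriv (x i) y v (n i) (fun h => hy ⟨i, h.symm⟩))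
  unfold u0 CC
  convert this using 4
  simp [sum_inner, inner_smul_left]

lemma u0_norm_le {N : ℕ} (x : Fin N → E2) (n : Fin N → ℤ) (y : E2) : ‖u0 x n y‖ ≤ 1 := by
  rw [u0, norm_prod]
  exact Finset.prod_le_one (fun i _ => norm_nonneg _) (fun i _ => vort_zpow_norm_le _ _ _)

lemma u0_norm {N : ℕ} (x : Fin N → E2) (n : Fin N → ℤ) (y : E2) (hy : y ∉ Set.range x) : ‖u0 x n y‖ = 1 := by
  rw [u0, norm_prod]
  refine Finset.prod_eq_one fun i _ => ?_
  rw [norm_zpow, vort_norm _ _ (fun h => hy ⟨i, h.symm⟩), one_zpow]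

lemma u0_measurable {N : ℕ} (x : Fin N → E2) (n : Fin N → ℤ) : Measurable (u0 x n) := by
  unfold u0
  refine Finset.measurable_prod _ fun i _ => ?_
  exact (vort_measurable (x i)).pow_const (n i)

lemma CC_measurable {N : ℕ} (x : Fin N → E2) (n : Fin N → ℤ) : Measurable (CC x n) := by
  unfold CC
  refine Finset.measurable_sum _ fun i _ => ?_
  exact (KK_measurable (x i)).const_smul (n i : ℝ)

lemma CC_locInt {N : ℕ} (x : Fin N → E2) (n : Fin N → ℤ) : LocallyIntegrable (CC x n) := by
  unfold CC
  refine locallyIntegrable_finsetSum _ fun i _ => ?_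
  exact (KK_locInt (x i)).smul (n i : ℝ)

lemma CC_curl {N : ℕ} (x : Fin N → E2) (n : Fin N → ℤ) (φ : E2 → ℝ) (hφ : ContDiff ℝ 1 φ) (hc : HasCompactSupport φ) :
    Integrable (fun y => CC x n y 0 * fderiv ℝ φ y (EuclideanSpace.single 1 1) - CC x n y 1 * fderiv ℝ φ y (EuclideanSpace.single 0 1)) ∧
    ∫ y, (CC x n y 0 * fderiv ℝ φ y (EuclideanSpace.single 1 1) - CC x n y 1 * fderiv ℝ φ y (EuclideanSpace.single 0 1))
      = 2 * π * ∑ i, (n i : ℝ) * φ (x i) := by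
  have hexp : ∀ v : E2, v = v 0 • EuclideanSpace.single 0 1 + v 1 • EuclideanSpace.single 1 1 := by
    intro v; ext i; fin_cases i <;> simp
  have hpt : ∀ a y, KK a y 0 * fderiv ℝ φ y (EuclideanSpace.single 1 1) - KK a y 1 * fderiv ℝ φ y (EuclideanSpace.single 0 1)
      = - ((‖y - a‖ ^ 2)⁻¹ * fderiv ℝ φ y (y - a)) := by
    intro a y
    have e := congrArg (fderiv ℝ φ y) (hexp (y - a))
    rw [map_add, map_smul, map_smul, smul_eq_mul, smul_eq_mul] at e
    rw [e]
    simp [KK]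
    ring
  have hi : ∀ a, Integrable (fun y => KK a y 0 * fderiv ℝ φ y (EuclideanSpace.single 1 1) - KK a y 1 * fderiv ℝ φ y (EuclideanSpace.single 0 1)) := by
    intro a
    have hd : ∀ j k : Fin 2, Integrable (fun y => KK a y k * fderiv ℝ φ y (EuclideanSpace.single j 1)) := by
      intro j k
      have h1 := (KK_locInt a).integrable_smul_left_of_hasCompactSupport (g := fun y => fderiv ℝ φ y (EuclideanSpace.single j 1))
        ((hφ.continuous_fderiv (by norm_num)).clm_apply continuous_const) (hc.fderiv_apply ℝ _)
      have h2 := (EuclideanSpace.proj k : E2 →L[ℝ] ℝ).integrable_comp h1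
      simpa [mul_comm] using h2
    exact (hd 1 0).sub (hd 0 1)
  have hs : ∀ y, (CC x n y 0 * fderiv ℝ φ y (EuclideanSpace.single 1 1) - CC x n y 1 * fderiv ℝ φ y (EuclideanSpace.single 0 1))
     = ∑ i, (n i : ℝ) * (KK (x i) y 0 * fderiv ℝ φ y (EuclideanSpace.single 1 1) - KK (x i) y 1 * fderiv ℝ φ y (EuclideanSpace.single 0 1)) := by
    intro y
    simp only [CC, WithLp.ofLp_sum, Finset.sum_apply, PiLp.smul_apply, smul_eq_mul, Finset.sum_mul, mul_sub, Finset.sum_sub_distrib, mul_assoc]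
  simp only [hs]
  refine ⟨integrable_finsetSum _ fun i _ => (hi (x i)).const_mul _, ?_⟩
  rw [integral_finsetSum _ fun i _ => (hi (x i)).const_mul _, Finset.mul_sum]
  refine Finset.sum_congr rfl fun i _ => ?_
  rw [integral_const_mul]
  simp only [hpt]
  rw [integral_neg, integral_radial _ _ hφ hc]
  ring


lemma intA (X : E2 → E2) (hX : LocallyIntegrable X) (q : E2 → ℂ) (hqm : Measurable q) (hq : ∀ y, ‖q y‖ ≤ 1)
    (φ : E2 → ℝ) (hφ : ContDiff ℝ (⊤ : ℕ∞) φ) (hc : HasCompactSupport φ) (j : Fin 2) :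
    Integrable (fun y => q y * (fderiv ℝ φ y (EuclideanSpace.single j 1) : ℂ)) ∧
    Integrable (fun y => Complex.I * (X y j : ℂ) * q y * (φ y : ℂ)) := by
  constructor
  · have h1 : Integrable (fun y => fderiv ℝ φ y (EuclideanSpace.single j 1)) :=
      ((hφ.continuous_fderiv (by simp)).clm_apply continuous_const).integrable_of_hasCompactSupport (hc.fderiv_apply ℝ _)
    exact h1.ofReal.bdd_mul hqm.aestronglyMeasurable (Filter.Eventually.of_forall hq)
  · have h1 := hX.integrable_smul_left_of_hasCompactSupport hφ.continuous hc
    have h2 := (EuclideanSpace.proj j : E2 →L[ℝ] ℝ).integrable_comp h1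
    have h3 := (h2.ofReal (𝕜 := ℂ)).bdd_mul (f := fun y => Complex.I * q y) (c := 1) (by fun_prop)
      (Filter.Eventually.of_forall fun y => by simpa using hq y)
    refine h3.congr (Filter.Eventually.of_forall fun y => ?_)
    simp
    ring

lemma weak_id {N : ℕ} (x : Fin N → E2) (n : Fin N → ℤ) (W : E2 → E2) (hWm : Measurable W) (hW : Integrable W)
    (hcurl : ∀ φ : E2 → ℝ, ContDiff ℝ (⊤ : ℕ∞) φ → HasCompactSupport φ → tsupport φ ⊆ ball 0 1 →
      ∫ y, (W y 0 * fderiv ℝ φ y (EuclideanSpace.single 1 1) - W y 1 * fderiv ℝ φ y (EuclideanSpace.single 0 1)) = 0)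
    (φ : E2 → ℝ) (hφ : ContDiff ℝ (⊤ : ℕ∞) φ) (hc : HasCompactSupport φ) (hs : tsupport φ ⊆ ball 0 1) (j : Fin 2) :
    ∫ y, (u0 x n y * Complex.exp (Complex.I * (pot W y : ℂ)) * (fderiv ℝ φ y (EuclideanSpace.single j 1) : ℂ)
      + Complex.I * ((CC x n y + W y) j : ℂ) * (u0 x n y * Complex.exp (Complex.I * (pot W y : ℂ))) * (φ y : ℂ)) = 0 := by
  obtain ⟨r', hr', hsr⟩ := exists_lt_subset_ball (isClosed_tsupport φ) hs
  set r := max r' (3/4) with hrdef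
  have hr1 : r < 1 := max_lt hr' (by norm_num)
  have hr2 : 1/2 < r := lt_of_lt_of_le (by norm_num) (le_max_right _ _)
  have hsr2 : tsupport φ ⊆ ball 0 r := hsr.trans (ball_subset_ball (le_max_left _ _))
  obtain ⟨P, U, hPm, hUc, hUi, hPU, hUW, hPt⟩ := exists_pot W hWm hW r hr2 hr1 hcurl
  set e : E2 := EuclideanSpace.single j 1 with he
  have hin : ∀ w : E2, ⟪w, e⟫ = w j := by
    intro w; rw [he, EuclideanSpace.inner_single_right]; simp
  have hu0m := u0_measurable x n
  have hle : ∀ (f : E2 → ℝ) y, ‖u0 x n y * Complex.exp (Complex.I * (f y : ℂ))‖ ≤ 1 := by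
    intro f y
    rw [norm_mul, mul_comm Complex.I, Complex.norm_exp_ofReal_mul_I, mul_one]
    exact u0_norm_le x n y
  have hmm : ∀ f : E2 → ℝ, Measurable f → Measurable fun y => u0 x n y * Complex.exp (Complex.I * (f y : ℂ)) := by
    intro f hf
    fun_prop
  have hφd : ∀ y, HasFDerivAt φ (fderiv ℝ φ y) y := fun y => (hφ.differentiable (by simp) y).hasFDerivAt
  have hz : ∀ y ∉ tsupport φ, φ y = 0 ∧ fderiv ℝ φ y e = 0 := by
    intro y hy
    refine ⟨image_eq_zero_of_notMem_tsupport hy, ?_⟩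
    have : fderiv ℝ φ y = 0 := by
      by_contra h
      exact hy (support_fderiv_subset ℝ h)
    rw [this]; rfl
  have hCU : ∀ k, LocallyIntegrable (fun y => CC x n y + U k y) := fun k =>
    (CC_locInt x n).add (hUi k).locallyIntegrable
  have hCW : LocallyIntegrable (fun y => CC x n y + W y) :=
    (CC_locInt x n).add hW.locallyIntegrable
  have hpotm := pot_measurable W hWm
  -- step 1
  have s1 : ∀ k, ∫ y, (u0 x n y * Complex.exp (Complex.I * (P k y : ℂ)) * (fderiv ℝ φ y e : ℂ)
      + Complex.I * ((CC x n y + U k y) j : ℂ) * (u0 x n y * Complex.exp (Complex.I * (P k y : ℂ))) * (φ y : ℂ)) = 0 := by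
    intro k
    obtain ⟨i1, i2⟩ := intA _ (hCU k) _ (hmm _ (hPm k)) (hle (P k)) φ hφ hc j
    refine integral_line_zero (Set.range x) (Set.finite_range x) j
      (fun y => u0 x n y * Complex.exp (Complex.I * (P k y : ℂ)) * (φ y : ℂ)) _ ?_ (i1.add i2) ?_
    · have h1 : Integrable φ := hφ.continuous.integrable_of_hasCompactSupport hc
      exact h1.ofReal.bdd_mul (hmm _ (hPm k)).aestronglyMeasurable (Filter.Eventually.of_forall (hle (P k)))
    · intro y hy
      by_cases hyt : y ∈ tsupport φ
      · have d1 := u0_deriv x n y e hy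
        have d2 := (hPU k y (hsr2 hyt)).hasLineDerivAt e
        have d3 := (hφd y).hasLineDerivAt e
        unfold HasLineDerivAt at d1 d2 d3 ⊢
        have d4 := ((d2.ofReal_comp).const_mul Complex.I).cexp
        have d5 := (d1.mul d4).mul d3.ofReal_comp
        refine d5.congr_deriv ?_
        simp only [Pi.mul_apply, zero_smul, add_zero, innerSL_apply_apply, hin, PiLp.add_apply]
        push_cast
        ring
      · obtain ⟨z1, z2⟩ := hz y hyt
        have hev : (fun y => u0 x n y * Complex.exp (Complex.I * (P k y : ℂ)) * (φ y : ℂ)) =ᶠ[nhds y] fun _ => 0 := by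
          filter_upwards [(isClosed_tsupport φ).isOpen_compl.mem_nhds hyt] with w hw
          simp [(hz w hw).1]
        rw [z1, z2]
        have h0 : HasLineDerivAt ℝ (fun _ : E2 => (0:ℂ)) 0 y e := by
          unfold HasLineDerivAt
          exact hasDerivAt_const _ _
        have := h0.congr_of_eventuallyEq hev
        simpa using this
  -- step 2
  obtain ⟨b1, b2⟩ := intA _ hCW _ (measurable_const (a := (1:ℂ))) (by simp) φ hφ hc j
  have s2 : Filter.Tendsto (fun k => ∫ y, (u0 x n y * Complex.exp (Complex.I * (P k y : ℂ)) * (fderiv ℝ φ y e : ℂ)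
      + Complex.I * ((CC x n y + W y) j : ℂ) * (u0 x n y * Complex.exp (Complex.I * (P k y : ℂ))) * (φ y : ℂ))) Filter.atTop
      (nhds (∫ y, (u0 x n y * Complex.exp (Complex.I * (pot W y : ℂ)) * (fderiv ℝ φ y e : ℂ)
      + Complex.I * ((CC x n y + W y) j : ℂ) * (u0 x n y * Complex.exp (Complex.I * (pot W y : ℂ))) * (φ y : ℂ)))) := by
    refine tendsto_integral_of_dominated_convergence _ (fun k => ?_) (b1.norm.add b2.norm) (fun k => ?_) ?_
    · obtain ⟨i1, i2⟩ := intA _ hCW _ (hmm _ (hPm k)) (hle (P k)) φ hφ hc j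
      exact (i1.add i2).aestronglyMeasurable
    · refine Filter.Eventually.of_forall fun y => (norm_add_le _ _).trans ?_
      have := hle (P k) y
      simp only [Pi.add_apply]
      simp only [norm_mul, Complex.norm_I, one_mul, mul_one] at this ⊢
      refine add_le_add ?_ ?_
      · exact mul_le_of_le_one_left (norm_nonneg _) this
      · refine mul_le_mul_of_nonneg_right ?_ (norm_nonneg _)
        exact mul_le_of_le_one_right (norm_nonneg _) this
    · rw [ae_restrict_iff' measurableSet_ball] at hPt
      filter_upwards [hPt] with y hy
      by_cases hyb : y ∈ ball (0:E2) 1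
      · have h1 := hy hyb
        have h2 : Filter.Tendsto (fun k => u0 x n y * Complex.exp (Complex.I * (P k y : ℂ))) Filter.atTop
            (nhds (u0 x n y * Complex.exp (Complex.I * (pot W y : ℂ)))) :=
          (((Complex.continuous_exp.comp (continuous_const.mul Complex.continuous_ofReal)).tendsto _).comp h1).const_mul _
        exact (h2.mul_const _).add ((h2.const_mul _).mul_const _)
      · obtain ⟨z1, z2⟩ := hz y (fun h => hyb (hs h))
        simp [z1, z2]
  -- step 3
  have s3 : Filter.Tendsto (fun k => ∫ y, (u0 x n y * Complex.exp (Complex.I * (P k y : ℂ)) * (fderiv ℝ φ y e : ℂ)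
      + Complex.I * ((CC x n y + W y) j : ℂ) * (u0 x n y * Complex.exp (Complex.I * (P k y : ℂ))) * (φ y : ℂ))) Filter.atTop
      (nhds 0) := by
    obtain ⟨M, hM⟩ := hφ.continuous.bounded_above_of_compact_support hc
    have hlim : Filter.Tendsto (fun k => M * ∫ y, ‖U k y - W y‖) Filter.atTop (nhds 0) := by
      simpa using hUW.const_mul M
    refine squeeze_zero_norm (fun k => ?_) hlim
    obtain ⟨i1, i2⟩ := intA _ hCW _ (hmm _ (hPm k)) (hle (P k)) φ hφ hc j
    obtain ⟨i3, i4⟩ := intA _ (hCU k) _ (hmm _ (hPm k)) (hle (P k)) φ hφ hc j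
    rw [← sub_zero (∫ y, _), ← s1 k, ← integral_const_mul]
    refine (congrArg norm (integral_sub (i1.add i2) (i3.add i4)).symm).trans_le ?_
    refine norm_integral_le_of_norm_le (((hUi k).sub hW).norm.const_mul M) (Filter.Eventually.of_forall fun y => ?_)
    have heq : (u0 x n y * Complex.exp (Complex.I * (P k y : ℂ)) * (fderiv ℝ φ y e : ℂ)
      + Complex.I * ((CC x n y + W y) j : ℂ) * (u0 x n y * Complex.exp (Complex.I * (P k y : ℂ))) * (φ y : ℂ)) -
      (u0 x n y * Complex.exp (Complex.I * (P k y : ℂ)) * (fderiv ℝ φ y e : ℂ)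
      + Complex.I * ((CC x n y + U k y) j : ℂ) * (u0 x n y * Complex.exp (Complex.I * (P k y : ℂ))) * (φ y : ℂ))
      = -(Complex.I * (((U k y - W y) j : ℝ) : ℂ) * (u0 x n y * Complex.exp (Complex.I * (P k y : ℂ))) * (φ y : ℂ)) := by
      simp only [PiLp.add_apply, PiLp.sub_apply]
      push_cast
      ring
    refine (congrArg norm heq).trans_le ?_
    have h1 := hle (P k) y
    have h2 : ‖(U k y - W y) j‖ ≤ ‖U k y - W y‖ := PiLp.norm_apply_le _ j
    rw [norm_neg, norm_mul, norm_mul, norm_mul, Complex.norm_I, one_mul, Complex.norm_real, Complex.norm_real]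
    have h3 := hM y
    calc _ ≤ ‖U k y - W y‖ * 1 * M := by gcongr
      _ = _ := by ring
  exact tendsto_nhds_unique s2 s3


end Helpers

/-- Let `p > 1`, let `x₁,…,x_N` be distinct points of the open unit ball `B² ⊂ ℝ²`,
`n₁,…,n_N ∈ ℤ`, and let `V : B² → ℝ²` be measurable with `∫_{B²} ‖V‖^p < ∞` and
distributional divergence `2π ∑ n_i δ_{x_i}` (in the sense that
`∫ ⟨V, ∇φ⟩ = 2π ∑ n_i φ(x_i)` for all smooth compactly supported `φ` supported in
`B²`). Then there is a measurable `u = (u₁, u₂) : B² → ℝ²` with `‖u‖ = 1` a.e.,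
whose components admit weak partial derivatives `g_{ij} ∈ L^p(B²)`
(`∫ u_i ∂_jφ = −∫ g_{ij} φ` for all test functions `φ`), such that
`V = u₁ ∇⊥u₂ − u₂ ∇⊥u₁` a.e. on `B²`, where `∇⊥u_i = (−g_{i2}, g_{i1})`. -/
theorem Lp_field_with_current_divergence_is_rotated_gradient
    (p : ℝ) (hp : 1 < p) (N : ℕ)
    (x : Fin N → EuclideanSpace ℝ (Fin 2))
    (hx : ∀ i, x i ∈ ball (0 : EuclideanSpace ℝ (Fin 2)) 1)
    (hinj : Function.Injective x) (n : Fin N → ℤ)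
    (V : EuclideanSpace ℝ (Fin 2) → EuclideanSpace ℝ (Fin 2))
    (hVmeas : Measurable V)
    (hVLp : IntegrableOn (fun y => ‖V y‖ ^ p)
      (ball (0 : EuclideanSpace ℝ (Fin 2)) 1) volume)
    (hVint : IntegrableOn V (ball (0 : EuclideanSpace ℝ (Fin 2)) 1) volume)
    (hdiv : ∀ φ : EuclideanSpace ℝ (Fin 2) → ℝ, ContDiff ℝ (⊤ : ℕ∞) φ →
      HasCompactSupport φ → tsupport φ ⊆ ball (0 : EuclideanSpace ℝ (Fin 2)) 1 →
      (∫ y in ball (0 : EuclideanSpace ℝ (Fin 2)) 1, ⟪V y, gradient φ y⟫)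
        = 2 * π * ∑ i : Fin N, (n i : ℝ) * φ (x i)) :
    ∃ u₁ u₂ g₁₁ g₁₂ g₂₁ g₂₂ : EuclideanSpace ℝ (Fin 2) → ℝ,
      Measurable u₁ ∧ Measurable u₂ ∧
      Measurable g₁₁ ∧ Measurable g₁₂ ∧ Measurable g₂₁ ∧ Measurable g₂₂ ∧
      (∀ᵐ y ∂(volume.restrict (ball (0 : EuclideanSpace ℝ (Fin 2)) 1)),
        u₁ y ^ 2 + u₂ y ^ 2 = 1) ∧
      IntegrableOn (fun y => |g₁₁ y| ^ p) (ball (0 : EuclideanSpace ℝ (Fin 2)) 1)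
        volume ∧
      IntegrableOn (fun y => |g₁₂ y| ^ p) (ball (0 : EuclideanSpace ℝ (Fin 2)) 1)
        volume ∧
      IntegrableOn (fun y => |g₂₁ y| ^ p) (ball (0 : EuclideanSpace ℝ (Fin 2)) 1)
        volume ∧
      IntegrableOn (fun y => |g₂₂ y| ^ p) (ball (0 : EuclideanSpace ℝ (Fin 2)) 1)
        volume ∧
      (∀ φ : EuclideanSpace ℝ (Fin 2) → ℝ, ContDiff ℝ (⊤ : ℕ∞) φ →
        HasCompactSupport φ → tsupport φ ⊆ ball (0 : EuclideanSpace ℝ (Fin 2)) 1 →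
        ((∫ y in ball (0 : EuclideanSpace ℝ (Fin 2)) 1,
            u₁ y * fderiv ℝ φ y (EuclideanSpace.single 0 1))
          = -∫ y in ball (0 : EuclideanSpace ℝ (Fin 2)) 1, g₁₁ y * φ y) ∧
        ((∫ y in ball (0 : EuclideanSpace ℝ (Fin 2)) 1,
            u₁ y * fderiv ℝ φ y (EuclideanSpace.single 1 1))
          = -∫ y in ball (0 : EuclideanSpace ℝ (Fin 2)) 1, g₁₂ y * φ y) ∧
        ((∫ y in ball (0 : EuclideanSpace ℝ (Fin 2)) 1,
            u₂ y * fderiv ℝ φ y (EuclideanSpace.single 0 1))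
          = -∫ y in ball (0 : EuclideanSpace ℝ (Fin 2)) 1, g₂₁ y * φ y) ∧
        ((∫ y in ball (0 : EuclideanSpace ℝ (Fin 2)) 1,
            u₂ y * fderiv ℝ φ y (EuclideanSpace.single 1 1))
          = -∫ y in ball (0 : EuclideanSpace ℝ (Fin 2)) 1, g₂₂ y * φ y)) ∧
      (∀ᵐ y ∂(volume.restrict (ball (0 : EuclideanSpace ℝ (Fin 2)) 1)),
        V y 0 = u₁ y * (-(g₂₂ y)) - u₂ y * (-(g₁₂ y)) ∧
        V y 1 = u₁ y * g₂₁ y - u₂ y * g₁₁ y) := by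
  classical
  set B : Set E2 := ball (0 : E2) 1 with hB
  have hBm : MeasurableSet B := measurableSet_ball
  -- the rotated field
  let W : E2 → E2 := fun y => !₂[V y 1, -(V y 0)]
  have hW0 : ∀ y, W y 0 = V y 1 := fun y => rfl
  have hW1 : ∀ y, W y 1 = -(V y 0) := fun y => rfl
  have hWn : ∀ y, ‖W y‖ = ‖V y‖ := by
    intro y
    simp [EuclideanSpace.norm_eq, Fin.sum_univ_two, hW0, hW1, add_comm]
  have hWm : Measurable W := by
    have hl : Continuous (fun v : E2 => (!₂[v 1, -(v 0)] : E2)) := by fun_prop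
    exact hl.measurable.comp hVmeas
  have hWi : IntegrableOn W B :=
    Integrable.mono hVint hWm.aestronglyMeasurable (Filter.Eventually.of_forall fun y => (hWn y).le)
  have hCi : IntegrableOn (CC x n) B :=
    ((CC_locInt x n).integrableOn_isCompact (isCompact_closedBall (0:E2) 1)).mono_set ball_subset_closedBall
  let W' : E2 → E2 := B.indicator (fun y => W y - CC x n y)
  have hW'm : Measurable W' := (hWm.sub (CC_measurable x n)).indicator hBm
  have hW'i : Integrable W' := (integrable_indicator_iff hBm).2 (hWi.sub hCi)
  have hexp : ∀ v : E2, v = v 0 • EuclideanSpace.single 0 1 + v 1 • EuclideanSpace.single 1 1 := by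
    intro v; ext i; fin_cases i <;> simp
  have hz : ∀ φ : E2 → ℝ, tsupport φ ⊆ B → ∀ y ∉ B, φ y = 0 ∧ fderiv ℝ φ y = 0 := by
    intro φ hs y hy
    refine ⟨image_eq_zero_of_notMem_tsupport fun h => hy (hs h), ?_⟩
    by_contra h
    exact hy (hs (support_fderiv_subset ℝ h))
  have hgrad : ∀ (φ : E2 → ℝ) y, ⟪V y, gradient φ y⟫ = fderiv ℝ φ y (V y) := by
    intro φ y
    rw [gradient, real_inner_comm, InnerProductSpace.toDual_symm_apply]
  have hcurl : ∀ φ : E2 → ℝ, ContDiff ℝ (⊤ : ℕ∞) φ → HasCompactSupport φ → tsupport φ ⊆ ball 0 1 →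
      ∫ y, (W' y 0 * fderiv ℝ φ y (EuclideanSpace.single 1 1) - W' y 1 * fderiv ℝ φ y (EuclideanSpace.single 0 1)) = 0 := by
    intro φ hφ hc hs
    obtain ⟨c1, c2⟩ := CC_curl x n φ (hφ.of_le (by exact_mod_cast le_top)) hc
    have hd := hdiv φ hφ hc hs
    simp only [hgrad] at hd
    have hcd : Continuous (fderiv ℝ φ) := hφ.continuous_fderiv (by simp)
    obtain ⟨M, hM⟩ := hcd.bounded_above_of_compact_support (hc.fderiv ℝ)
    have hi : IntegrableOn (fun y => fderiv ℝ φ y (V y)) B := by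
      refine Integrable.mono' (hVint.norm.const_mul M) ?_ (Filter.Eventually.of_forall fun y => ?_)
      · have : Measurable (fun y => fderiv ℝ φ y (V y)) := by
          have h2 : Continuous (fun z : E2 × E2 => fderiv ℝ φ z.1 z.2) :=
            (hcd.comp continuous_fst).clm_apply continuous_snd
          exact h2.measurable.comp (measurable_id.prodMk hVmeas)
        exact this.aestronglyMeasurable
      · exact ((fderiv ℝ φ y).le_opNorm _).trans (mul_le_mul_of_nonneg_right (hM y) (norm_nonneg _))
    have heq : ∀ y, (W' y 0 * fderiv ℝ φ y (EuclideanSpace.single 1 1) - W' y 1 * fderiv ℝ φ y (EuclideanSpace.single 0 1))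
        = B.indicator (fun y => fderiv ℝ φ y (V y)) y -
          (CC x n y 0 * fderiv ℝ φ y (EuclideanSpace.single 1 1) - CC x n y 1 * fderiv ℝ φ y (EuclideanSpace.single 0 1)) := by
      intro y
      by_cases hy : y ∈ B
      · have e := congrArg (fderiv ℝ φ y) (hexp (V y))
        rw [map_add, map_smul, map_smul, smul_eq_mul, smul_eq_mul] at e
        simp only [W', Set.indicator_of_mem hy, PiLp.sub_apply, hW0, hW1]
        rw [e]
        ring
      · simp [W', hy, (hz φ hs y hy).2]
    simp only [heq]
    rw [integral_sub ((integrable_indicator_iff hBm).2 hi) c1, c2, integral_indicator hBm, hd, sub_self]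
  let q : E2 → ℂ := fun y => u0 x n y * Complex.exp (Complex.I * (pot W' y : ℂ))
  have hu0m := u0_measurable x n
  have hpm := pot_measurable W' hW'm
  have hqm : Measurable q := by
    show Measurable fun y => u0 x n y * Complex.exp (Complex.I * (pot W' y : ℂ))
    fun_prop
  have hqn : ∀ y, ‖q y‖ = ‖u0 x n y‖ := by
    intro y
    show ‖u0 x n y * Complex.exp (Complex.I * (pot W' y : ℂ))‖ = _
    rw [norm_mul, mul_comm Complex.I, Complex.norm_exp_ofReal_mul_I, mul_one]
  have hq1 : ∀ y, ‖q y‖ ≤ 1 := fun y => (hqn y).trans_le (u0_norm_le x n y)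
  have hqre : ∀ y, |(q y).re| ≤ 1 := fun y => (Complex.abs_re_le_norm _).trans (hq1 y)
  have hqim : ∀ y, |(q y).im| ≤ 1 := fun y => (Complex.abs_im_le_norm _).trans (hq1 y)
  have hone : ∀ᵐ y ∂(volume.restrict B), (q y).re ^ 2 + (q y).im ^ 2 = 1 := by
    refine ae_restrict_of_ae ?_
    have h0 : volume (Set.range x) = 0 := (Set.finite_range x).measure_zero volume
    filter_upwards [measure_eq_zero_iff_ae_notMem.1 h0] with y hy
    have h1 : ‖q y‖ = 1 := (hqn y).trans (u0_norm x n y hy)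
    have h2 := Complex.sq_norm (q y)
    rw [h1, Complex.normSq_apply] at h2
    linarith
  have hWjm : ∀ j : Fin 2, Measurable fun y => W y j := by
    intro j
    exact (EuclideanSpace.proj j : E2 →L[ℝ] ℝ).continuous.measurable.comp hWm
  have hrem : Measurable fun y => (q y).re := Complex.measurable_re.comp hqm
  have himm : Measurable fun y => (q y).im := Complex.measurable_im.comp hqm
  have hLp : ∀ (g : E2 → ℝ), Measurable g → (∀ y, |g y| ≤ ‖V y‖) → IntegrableOn (fun y => |g y| ^ p) B := by
    intro g hg hle
    refine Integrable.mono' hVLp ?_ (Filter.Eventually.of_forall fun y => ?_)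
    · have : Measurable fun y => |g y| ^ p := by fun_prop
      exact this.aestronglyMeasurable
    · rw [Real.norm_of_nonneg (by positivity)]
      exact Real.rpow_le_rpow (abs_nonneg _) (hle y) (by linarith)
  have hWj : ∀ (j : Fin 2) y, |W y j| ≤ ‖V y‖ := fun j y => (PiLp.norm_apply_le (W y) j).trans (hWn y).le
  have hb : ∀ (j : Fin 2) (c : ℝ) y, |c| ≤ 1 → |W y j * c| ≤ ‖V y‖ := by
    intro j c y h
    rw [abs_mul]
    exact (mul_le_of_le_one_right (abs_nonneg _) h).trans (hWj j y)
  have key : ∀ φ : E2 → ℝ, ContDiff ℝ (⊤ : ℕ∞) φ → HasCompactSupport φ → tsupport φ ⊆ B → ∀ j : Fin 2,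
      ((∫ y in B, (q y).re * fderiv ℝ φ y (EuclideanSpace.single j 1)) = -∫ y in B, (-(W y j * (q y).im)) * φ y) ∧
      ((∫ y in B, (q y).im * fderiv ℝ φ y (EuclideanSpace.single j 1)) = -∫ y in B, (W y j * (q y).re) * φ y) := by
    intro φ hφ hc hs j
    have hw := weak_id x n W' hW'm hW'i hcurl φ hφ hc hs j
    have hCW : LocallyIntegrable (fun y => CC x n y + W' y) := (CC_locInt x n).add hW'i.locallyIntegrable
    obtain ⟨i1, i2⟩ := intA _ hCW q hqm hq1 φ hφ hc j
    have hCWB : ∀ y ∈ B, CC x n y + W' y = W y := by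
      intro y hy
      simp [W', Set.indicator_of_mem hy]
    rw [← setIntegral_eq_integral_of_forall_compl_eq_zero (s := B) (fun y hy => by
      obtain ⟨z1, z2⟩ := hz φ hs y hy
      simp [z1, z2])] at hw
    have i2' : IntegrableOn (fun y => Complex.I * (W y j : ℂ) * q y * (φ y : ℂ)) B := by
      refine i2.integrableOn.congr_fun (fun y hy => ?_) hBm
      simp only [hCWB y hy]
    have hw2 : ∫ y in B, (q y * (fderiv ℝ φ y (EuclideanSpace.single j 1) : ℂ) + Complex.I * (W y j : ℂ) * q y * (φ y : ℂ)) = 0 := by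
      rw [← hw]
      refine setIntegral_congr_fun hBm (fun y hy => ?_)
      simp only [hCWB y hy]
      rfl
    rw [integral_add i1.integrableOn i2'] at hw2
    have r1 := Complex.reCLM.integral_comp_comm i1.integrableOn (μ := volume.restrict B)
    have r2 := Complex.reCLM.integral_comp_comm i2'
    have r3 := Complex.imCLM.integral_comp_comm i1.integrableOn (μ := volume.restrict B)
    have r4 := Complex.imCLM.integral_comp_comm i2'
    have e1 := congrArg Complex.re hw2
    have e2 := congrArg Complex.im hw2
    simp only [Complex.reCLM_apply, Complex.imCLM_apply] at r1 r2 r3 r4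
    rw [Complex.add_re, ← r1, ← r2, Complex.zero_re] at e1
    rw [Complex.add_im, ← r3, ← r4, Complex.zero_im] at e2
    have f1 : ∀ y, (q y * (fderiv ℝ φ y (EuclideanSpace.single j 1) : ℂ)).re = (q y).re * fderiv ℝ φ y (EuclideanSpace.single j 1) := by
      intro y; simp
    have f2 : ∀ y, (q y * (fderiv ℝ φ y (EuclideanSpace.single j 1) : ℂ)).im = (q y).im * fderiv ℝ φ y (EuclideanSpace.single j 1) := by
      intro y; simp
    have f3 : ∀ y, (Complex.I * (W y j : ℂ) * q y * (φ y : ℂ)).re = (-(W y j * (q y).im)) * φ y := by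
      intro y; simp
    have f4 : ∀ y, (Complex.I * (W y j : ℂ) * q y * (φ y : ℂ)).im = (W y j * (q y).re) * φ y := by
      intro y; simp
    simp only [f1, f3] at e1
    simp only [f2, f4] at e2
    exact ⟨by linarith, by linarith⟩
  refine ⟨fun y => (q y).re, fun y => (q y).im, fun y => -(W y 0 * (q y).im), fun y => -(W y 1 * (q y).im),
    fun y => W y 0 * (q y).re, fun y => W y 1 * (q y).re, hrem, himm, ((hWjm 0).mul himm).neg, ((hWjm 1).mul himm).neg,
    (hWjm 0).mul hrem, (hWjm 1).mul hrem, hone, ?_, ?_, ?_, ?_, ?_, ?_⟩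
  · exact hLp _ ((hWjm 0).mul himm).neg fun y => by rw [abs_neg]; exact hb 0 _ y (hqim y)
  · exact hLp _ ((hWjm 1).mul himm).neg fun y => by rw [abs_neg]; exact hb 1 _ y (hqim y)
  · exact hLp _ ((hWjm 0).mul hrem) fun y => hb 0 _ y (hqre y)
  · exact hLp _ ((hWjm 1).mul hrem) fun y => hb 1 _ y (hqre y)
  · intro φ hφ hc hs
    obtain ⟨a1, a2⟩ := key φ hφ hc hs 0
    obtain ⟨a3, a4⟩ := key φ hφ hc hs 1
    exact ⟨a1, a3, a2, a4⟩
  · filter_upwards [hone] with y hy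
    simp only [hW0, hW1]
    constructor
    · linear_combination (-(V y 0)) * hy
    · linear_combination (-(V y 1)) * hy
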